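/- Let V be an n-dimensional complex vector space (n ≥ 5) with nondegenerate symmetric bilinear form g. Let W be an algebraic Weyl tensor (an algebraic curvature tensor with vanishing Ricci contraction). If the sectional curvature of W vanishes on every totally isotropic 2-plane in a nonempty open subset of the Grassmannian of totally isotropic 2-planes, then W = 0. -/

import Mathlib

open Filter Topology Matrix

/-- The reflection in the hyperplane orthogonal to `u`, multiplied by `u ⬝ᵥ u`; it is polynomial
in `u`. -/
def scaledReflection {n : ℕ} (u x : Fin n → ℂ) : Fin n → ℂ :=
  (u ⬝ᵥ u) • x - (2 * (x ⬝ᵥ u)) • u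

/-- The reflection in the hyperplane orthogonal to a non-null vector `u`. -/
noncomputable def dotReflection {n : ℕ} (u x : Fin n → ℂ) : Fin n → ℂ :=
  (u ⬝ᵥ u)⁻¹ • scaledReflection u x

/-- Both vectors are null and they are orthogonal to each other. -/
def IsotropicPair {n : ℕ} (p : (Fin n → ℂ) × (Fin n → ℂ)) : Prop :=
  p.1 ⬝ᵥ p.1 = 0 ∧ p.1 ⬝ᵥ p.2 = 0 ∧ p.2 ⬝ᵥ p.2 = 0

/-- The function `f` vanishes on all isotropic pairs close to `p`. -/
def VanishesNear {n : ℕ} (f : (Fin n → ℂ) → (Fin n → ℂ) → ℂ)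
    (p : (Fin n → ℂ) × (Fin n → ℂ)) : Prop :=
  ∀ᶠ q in 𝓝 p, IsotropicPair q → f q.1 q.2 = 0

section Reflections

variable {n : ℕ}

lemma scaledReflection_dotProduct (u x y : Fin n → ℂ) :
    scaledReflection u x ⬝ᵥ scaledReflection u y = (u ⬝ᵥ u) ^ 2 * (x ⬝ᵥ y) := by
  simp only [scaledReflection, sub_dotProduct, dotProduct_sub, smul_dotProduct, dotProduct_smul,
    smul_eq_mul, dotProduct_comm u y]
  ring

lemma scaledReflection_smul (u : Fin n → ℂ) (c : ℂ) (x : Fin n → ℂ) :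
    scaledReflection u (c • x) = c • scaledReflection u x := by
  simp only [scaledReflection, smul_dotProduct, smul_eq_mul]
  module

lemma scaledReflection_self_comp (u x : Fin n → ℂ) :
    scaledReflection u (scaledReflection u x) = (u ⬝ᵥ u) ^ 2 • x := by
  simp only [scaledReflection, sub_dotProduct, smul_dotProduct, smul_eq_mul]
  module

lemma dotReflection_dotReflection {u : Fin n → ℂ} (hu : u ⬝ᵥ u ≠ 0) (x : Fin n → ℂ) :
    dotReflection u (dotReflection u x) = x := by
  rw [dotReflection, dotReflection, scaledReflection_smul, scaledReflection_self_comp, smul_smul,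
    smul_smul]
  convert one_smul ℂ x using 2
  field_simp

lemma dotReflection_smul (u : Fin n → ℂ) (c : ℂ) (x : Fin n → ℂ) :
    dotReflection u (c • x) = c • dotReflection u x := by
  rw [dotReflection, dotReflection, scaledReflection_smul, smul_comm]

lemma scaledReflection_eq_smul {u : Fin n → ℂ} (hu : u ⬝ᵥ u ≠ 0) (x : Fin n → ℂ) :
    scaledReflection u x = (u ⬝ᵥ u) • dotReflection u x := by
  rw [dotReflection, smul_smul, mul_inv_cancel₀ hu, one_smul]

lemma dotReflection_of_orthogonal {u x : Fin n → ℂ} (hu : u ⬝ᵥ u ≠ 0) (hx : x ⬝ᵥ u = 0) :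
    dotReflection u x = x := by
  simp [dotReflection, scaledReflection, hx, smul_smul, inv_mul_cancel₀ hu]

lemma sub_dotProduct_self_ne_zero {x y : Fin n → ℂ} (hx : x ⬝ᵥ x = 0) (hy : y ⬝ᵥ y = 0)
    (hxy : x ⬝ᵥ y ≠ 0) : (x - y) ⬝ᵥ (x - y) ≠ 0 := by
  simp only [sub_dotProduct, dotProduct_sub, hx, hy, dotProduct_comm y x]
  intro h
  apply hxy
  linear_combination -h / 2

/-- The reflection in `x - y` exchanges two null vectors which are not orthogonal. -/
lemma dotReflection_sub_of_null {x y : Fin n → ℂ} (hx : x ⬝ᵥ x = 0) (hy : y ⬝ᵥ y = 0)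
    (hxy : x ⬝ᵥ y ≠ 0) : dotReflection (x - y) x = y := by
  rw [dotReflection, inv_smul_eq_iff₀ (sub_dotProduct_self_ne_zero hx hy hxy)]
  simp only [scaledReflection, sub_dotProduct, dotProduct_sub, hx, hy, dotProduct_comm y x]
  module

lemma continuous_dotReflection (u : Fin n → ℂ) : Continuous (dotReflection u) := by
  unfold dotReflection scaledReflection dotProduct
  fun_prop

lemma IsotropicPair.scaledReflection {x y : Fin n → ℂ} (h : IsotropicPair (x, y))
    (u : Fin n → ℂ) : IsotropicPair (scaledReflection u x, scaledReflection u y) := by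
  obtain ⟨h1, h2, h3⟩ := h
  dsimp only at h1 h2 h3
  simp [IsotropicPair, scaledReflection_dotProduct, h1, h2, h3]

lemma IsotropicPair.smul {x y : Fin n → ℂ} (h : IsotropicPair (x, y)) (c : ℂ) :
    IsotropicPair (c • x, c • y) := by
  obtain ⟨h1, h2, h3⟩ := h
  dsimp only at h1 h2 h3
  simp [IsotropicPair, h1, h2, h3]

lemma IsotropicPair.dotReflection {x y : Fin n → ℂ} (h : IsotropicPair (x, y))
    (u : Fin n → ℂ) : IsotropicPair (dotReflection u x, dotReflection u y) :=
  (h.scaledReflection u).smul _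

/-- If a homogeneous polynomial function vanishes on the isotropic pairs near `(x, y)`, then it
also vanishes on the isotropic pairs near the image of `(x, y)` under a product of two
reflections. -/
lemma VanishesNear.dotReflection_comp {f : (Fin n → ℂ) → (Fin n → ℂ) → ℂ}
    (hf : ∀ a b : ℂ → Fin n → ℂ, Differentiable ℂ a → Differentiable ℂ b →
      Differentiable ℂ fun t => f (a t) (b t))
    (hsmul : ∀ (c : ℂ) x y, f (c • x) (c • y) = c ^ 4 * f x y)
    {x y : Fin n → ℂ} (h : VanishesNear f (x, y)) {u v : Fin n → ℂ}
    (hu : u ⬝ᵥ u ≠ 0) (hv : v ⬝ᵥ v ≠ 0) :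
    VanishesNear f (dotReflection v (dotReflection u x), dotReflection v (dotReflection u y)) := by
  have key : ∀ᶠ q in 𝓝 (x, y), IsotropicPair q →
      f (dotReflection v (dotReflection u q.1)) (dotReflection v (dotReflection u q.2)) = 0 := by
    filter_upwards [eventually_eventually_nhds.2 h] with q hq hiso
    let γ : (Fin n → ℂ) → ℂ → Fin n → ℂ := fun z t =>
      (v ⬝ᵥ v)⁻¹ • dotReflection v (scaledReflection (v + t • (u - v)) z)
    have hγ : ∀ z, Differentiable ℂ (γ z) := by
      intro z
      simp only [γ, dotReflection, scaledReflection, dotProduct]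
      fun_prop
    have hγ0 : ∀ z, γ z 0 = z := by
      intro z
      simp only [γ, zero_smul, add_zero]
      rw [scaledReflection_eq_smul hv, dotReflection_smul, dotReflection_dotReflection hv,
        smul_smul, inv_mul_cancel₀ hv, one_smul]
    have hd := hf _ _ (hγ q.1) (hγ q.2)
    have hlim : Tendsto (fun t => (γ q.1 t, γ q.2 t)) (𝓝 0) (𝓝 q) := by
      have := ((hγ q.1).continuous.prodMk (hγ q.2).continuous).tendsto 0
      simpa only [hγ0] using this
    have hzero : (fun t => f (γ q.1 t) (γ q.2 t)) =ᶠ[𝓝 0] fun _ => 0 := by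
      filter_upwards [hlim.eventually hq] with t ht
      exact ht (((hiso.scaledReflection _).dotReflection v).smul _)
    have han : AnalyticOnNhd ℂ (fun t => f (γ q.1 t) (γ q.2 t)) Set.univ :=
      fun t _ => hd.analyticAt t
    have hall := han.eq_of_eventuallyEq (fun t _ => analyticAt_const) hzero
    have h1 := congrFun hall 1
    simp only [γ, one_smul, add_sub_cancel] at h1
    rw [scaledReflection_eq_smul hu, scaledReflection_eq_smul hu, dotReflection_smul,
      dotReflection_smul, hsmul, hsmul] at h1
    simpa [hu, hv] using h1
  have hback : Tendsto (fun q : (Fin n → ℂ) × (Fin n → ℂ) =>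
      (dotReflection u (dotReflection v q.1), dotReflection u (dotReflection v q.2)))
      (𝓝 (dotReflection v (dotReflection u x), dotReflection v (dotReflection u y)))
      (𝓝 (x, y)) := by
    have hc : Continuous fun q : (Fin n → ℂ) × (Fin n → ℂ) =>
        (dotReflection u (dotReflection v q.1), dotReflection u (dotReflection v q.2)) := by
      have := continuous_dotReflection u
      have := continuous_dotReflection v
      fun_prop
    have := hc.tendsto (dotReflection v (dotReflection u x), dotReflection v (dotReflection u y))
    simpa only [dotReflection_dotReflection hv, dotReflection_dotReflection hu] using this
  filter_upwards [hback.eventually key] with q hq hiso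
  simpa only [dotReflection_dotReflection hv, dotReflection_dotReflection hu] using
    hq ((hiso.dotReflection v).dotReflection u)

end Reflections

section StandardPairs

variable {n : ℕ}

/-- The vector `eᵢ + s eⱼ`, which is null when `s ^ 2 = -1`. -/
def nullVector (i j : Fin n) (s : ℂ) : Fin n → ℂ := Pi.single i 1 + s • Pi.single j 1

lemma dotProduct_nullVector (x : Fin n → ℂ) (i j : Fin n) (s : ℂ) :
    x ⬝ᵥ nullVector i j s = x i + s * x j := by
  simp [nullVector, dotProduct_add, dotProduct_smul]

lemma nullVector_dotProduct_self {i j : Fin n} (hij : i ≠ j) {s : ℂ} (hs : s ^ 2 = -1) :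
    nullVector i j s ⬝ᵥ nullVector i j s = 0 := by
  rw [dotProduct_nullVector]
  simp [nullVector, hij, hij.symm]
  linear_combination hs

lemma nullVector_dotProduct_of_disjoint {i j k l : Fin n} (hik : i ≠ k) (hil : i ≠ l)
    (hjk : j ≠ k) (hjl : j ≠ l) (s r : ℂ) :
    nullVector i j s ⬝ᵥ nullVector k l r = 0 := by
  rw [dotProduct_nullVector]
  simp [nullVector, hik.symm, hil.symm, hjk.symm, hjl.symm]

lemma single_dotProduct_self_ne_zero (m : Fin n) :
    (Pi.single m 1 : Fin n → ℂ) ⬝ᵥ Pi.single m 1 ≠ 0 := by simp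

lemma dotReflection_single_nullVector_of_ne {i j m : Fin n} (hi : m ≠ i) (hj : m ≠ j) (s : ℂ) :
    dotReflection (Pi.single m 1) (nullVector i j s) = nullVector i j s :=
  dotReflection_of_orthogonal (single_dotProduct_self_ne_zero m)
    (by simp [nullVector, hi, hj])

lemma dotReflection_single_nullVector_right {i j : Fin n} (hij : i ≠ j) (s : ℂ) :
    dotReflection (Pi.single j 1) (nullVector i j s) = nullVector i j (-s) := by
  simp [dotReflection, scaledReflection, nullVector, hij.symm]
  module

lemma single_sub_single_dotProduct_self {a b : Fin n} (hab : a ≠ b) :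
    (Pi.single a 1 - Pi.single b 1 : Fin n → ℂ) ⬝ᵥ (Pi.single a 1 - Pi.single b 1) = 2 := by
  simp [dotProduct_sub, hab, hab.symm]
  norm_num

lemma dotReflection_single_sub_single {a b : Fin n} (hab : a ≠ b) (x : Fin n → ℂ) :
    dotReflection (Pi.single a 1 - Pi.single b 1) x = x ∘ Equiv.swap a b := by
  ext m
  simp only [dotReflection, scaledReflection, single_sub_single_dotProduct_self hab]
  rcases eq_or_ne m a with rfl | ha
  · simp [dotProduct_sub, hab]; ring
  rcases eq_or_ne m b with rfl | hb
  · simp [dotProduct_sub, hab.symm]; ring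
  simp [dotProduct_sub, ha, hb, Equiv.swap_apply_of_ne_of_ne ha hb]

lemma dotReflection_single_sub_single_nullVector {a b : Fin n} (hab : a ≠ b) (i j : Fin n)
    (s : ℂ) : dotReflection (Pi.single a 1 - Pi.single b 1) (nullVector i j s) =
      nullVector (Equiv.swap a b i) (Equiv.swap a b j) s := by
  rw [dotReflection_single_sub_single hab]
  ext m
  simp only [nullVector, Function.comp, Pi.add_apply, Pi.smul_apply, Pi.single_apply,
    Equiv.swap_apply_eq_iff]

lemma exists_ne_of_five_le (hn : 5 ≤ n) (i j k l : Fin n) :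
    ∃ m, m ≠ i ∧ m ≠ j ∧ m ≠ k ∧ m ≠ l := by
  have hcard : ({i, j, k, l} : Finset (Fin n)).card < (Finset.univ : Finset (Fin n)).card := by
    have := Finset.card_le_four (a := i) (b := j) (c := k) (d := l)
    simp only [Finset.card_univ, Fintype.card_fin]
    omega
  obtain ⟨m, -, hm⟩ := Finset.exists_mem_notMem_of_card_lt_card hcard
  exact ⟨m, by simpa using hm⟩

/-- A nonzero coordinate of `x` makes `x` non-orthogonal to some `eᵢ + s eⱼ`. -/
lemma exists_sq_eq_neg_one_dotProduct_nullVector_ne_zero {x : Fin n → ℂ} {i : Fin n}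
    (hi : x i ≠ 0) (j : Fin n) : ∃ s : ℂ, s ^ 2 = -1 ∧ x ⬝ᵥ nullVector i j s ≠ 0 := by
  simp only [dotProduct_nullVector]
  by_contra! h
  have h1 := h Complex.I (by simp)
  have h2 := h (-Complex.I) (by simp)
  apply hi
  linear_combination h1 / 2 + h2 / 2

variable {f : (Fin n → ℂ) → (Fin n → ℂ) → ℂ}

/-- A product of two reflections moves any isotropic pair to a standard one. -/
lemma VanishesNear.exists_nullVector (hn : 5 ≤ n)
    (hf : ∀ a b : ℂ → Fin n → ℂ, Differentiable ℂ a → Differentiable ℂ b →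
      Differentiable ℂ fun t => f (a t) (b t))
    (hsmul : ∀ (c : ℂ) x y, f (c • x) (c • y) = c ^ 4 * f x y)
    {x y : Fin n → ℂ} (h : VanishesNear f (x, y)) (hiso : IsotropicPair (x, y))
    (hli : LinearIndependent ℂ ![x, y]) :
    ∃ (e : Fin 4 ↪ Fin n) (s r : ℂ), s ^ 2 = -1 ∧ r ^ 2 = -1 ∧
      VanishesNear f (nullVector (e 0) (e 1) s, nullVector (e 2) (e 3) r) := by
  obtain ⟨i, hi⟩ := Function.ne_iff.1 (hli.ne_zero 0)
  obtain ⟨j, hji, -⟩ := exists_ne_of_five_le hn i i i i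
  obtain ⟨s, hs, hxs⟩ := exists_sq_eq_neg_one_dotProduct_nullVector_ne_zero (x := x) hi j
  have hs0 := nullVector_dotProduct_self hji.symm hs
  set u := x - nullVector i j s
  have huu : u ⬝ᵥ u ≠ 0 := sub_dotProduct_self_ne_zero hiso.1 hs0 hxs
  have hux : dotReflection u x = nullVector i j s := dotReflection_sub_of_null hiso.1 hs0 hxs
  set y' := dotReflection u y with hy'
  have hiso' : IsotropicPair (nullVector i j s, y') := hux ▸ hiso.dotReflection u
  have hy0 : y' i + s * y' j = 0 := by
    rw [← dotProduct_nullVector, dotProduct_comm]; exact hiso'.2.1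
  obtain ⟨k, hk, hki, hkj⟩ : ∃ k, y' k ≠ 0 ∧ k ≠ i ∧ k ≠ j := by
    by_contra! hcon
    have hyc : y' = y' i • nullVector i j s := by
      ext m
      by_cases hmi : m = i
      · subst hmi; simp [nullVector, hji]
      by_cases hmj : m = j
      · subst hmj
        simp [nullVector, hji]
        linear_combination (-s) * hy0 + y' m * hs
      · have : y' m = 0 := by
          by_contra hm
          exact hmj (hcon m hm hmi)
        simp [nullVector, hmi, hmj, this]
    have hyx : y = y' i • x := by
      rw [← dotReflection_dotReflection huu x, hux, ← dotReflection_smul, ← hyc, hy',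
        dotReflection_dotReflection huu]
    have := (LinearIndependent.pair_iff.1 hli) (y' i) (-1) (by rw [← hyx]; simp)
    simp at this
  obtain ⟨l, hli, hlj, hlk, -⟩ := exists_ne_of_five_le hn i j k k
  obtain ⟨r, hr, hyr⟩ := exists_sq_eq_neg_one_dotProduct_nullVector_ne_zero hk l
  have hr0 := nullVector_dotProduct_self hlk.symm hr
  have hfix : dotReflection (y' - nullVector k l r) (nullVector i j s) = nullVector i j s := by
    apply dotReflection_of_orthogonal (sub_dotProduct_self_ne_zero hiso'.2.2 hr0 hyr)
    rw [dotProduct_sub, hiso'.2.1,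
      nullVector_dotProduct_of_disjoint hki.symm hli.symm hkj.symm hlj.symm, sub_zero]
  have hmain := h.dotReflection_comp hf hsmul huu
    (sub_dotProduct_self_ne_zero hiso'.2.2 hr0 hyr)
  rw [hux, hfix, ← hy', dotReflection_sub_of_null hiso'.2.2 hr0 hyr] at hmain
  refine ⟨⟨![i, j, k, l], ?_⟩, s, r, hs, hr, hmain⟩
  intro a b hab
  fin_cases a <;> fin_cases b <;> simp_all

lemma VanishesNear.perm (hn : 5 ≤ n)
    (hf : ∀ a b : ℂ → Fin n → ℂ, Differentiable ℂ a → Differentiable ℂ b →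
      Differentiable ℂ fun t => f (a t) (b t))
    (hsmul : ∀ (c : ℂ) x y, f (c • x) (c • y) = c ^ 4 * f x y) {i j k l : Fin n} {s r : ℂ}
    (h : VanishesNear f (nullVector i j s, nullVector k l r)) (σ : Equiv.Perm (Fin n)) :
    VanishesNear f (nullVector (σ i) (σ j) s, nullVector (σ k) (σ l) r) := by
  induction σ using Equiv.Perm.swap_induction_on with
  | one => exact h
  | swap_mul σ a b hab ih =>
    obtain ⟨m, h1, h2, h3, h4⟩ := exists_ne_of_five_le hn (σ i) (σ j) (σ k) (σ l)
    have := ih.dotReflection_comp hf hsmul (single_dotProduct_self_ne_zero m)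
      (v := Pi.single a 1 - Pi.single b 1) (by simp [single_sub_single_dotProduct_self hab])
    rwa [dotReflection_single_nullVector_of_ne h1 h2, dotReflection_single_nullVector_of_ne h3 h4,
      dotReflection_single_sub_single_nullVector hab,
      dotReflection_single_sub_single_nullVector hab] at this

/-- Vanishing near one standard isotropic pair propagates to all of them. -/
lemma VanishesNear.nullVector_of_nullVector (hn : 5 ≤ n)
    (hf : ∀ a b : ℂ → Fin n → ℂ, Differentiable ℂ a → Differentiable ℂ b →
      Differentiable ℂ fun t => f (a t) (b t))
    (hsmul : ∀ (c : ℂ) x y, f (c • x) (c • y) = c ^ 4 * f x y) {e : Fin 4 ↪ Fin n} {s r : ℂ}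
    (h : VanishesNear f (nullVector (e 0) (e 1) s, nullVector (e 2) (e 3) r))
    (hs : s ^ 2 = -1) (hr : r ^ 2 = -1) (e' : Fin 4 ↪ Fin n) {s' r' : ℂ}
    (hs' : s' ^ 2 = -1) (hr' : r' ^ 2 = -1) :
    VanishesNear f (nullVector (e' 0) (e' 1) s', nullVector (e' 2) (e' 3) r') := by
  have hne : ∀ {a b : Fin 4}, a ≠ b → e' a ≠ e' b := fun hab => e'.injective.ne hab
  have := Equiv.Perm.isMultiplyPretransitive (Fin n) 4
  obtain ⟨σ, hσ⟩ := MulAction.exists_smul_eq (Equiv.Perm (Fin n)) e e'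
  have hσe : ∀ a, σ (e a) = e' a := fun a => DFunLike.congr_fun hσ a
  have h1 := h.perm hn hf hsmul σ
  simp only [hσe] at h1
  obtain ⟨m, m0, m1, m2, m3⟩ := exists_ne_of_five_le hn (e' 0) (e' 1) (e' 2) (e' 3)
  have h2 : VanishesNear f (nullVector (e' 0) (e' 1) s', nullVector (e' 2) (e' 3) r) := by
    rcases sq_eq_sq_iff_eq_or_eq_neg.1 (hs'.trans hs.symm) with rfl | rfl
    · exact h1
    have := h1.dotReflection_comp hf hsmul (single_dotProduct_self_ne_zero m)
      (single_dotProduct_self_ne_zero (e' 1))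
    rwa [dotReflection_single_nullVector_of_ne m0 m1, dotReflection_single_nullVector_of_ne m2 m3,
      dotReflection_single_nullVector_right (hne (by decide)),
      dotReflection_single_nullVector_of_ne (hne (by decide)) (hne (by decide))] at this
  rcases sq_eq_sq_iff_eq_or_eq_neg.1 (hr'.trans hr.symm) with rfl | rfl
  · exact h2
  have := h2.dotReflection_comp hf hsmul (single_dotProduct_self_ne_zero m)
    (single_dotProduct_self_ne_zero (e' 3))
  rwa [dotReflection_single_nullVector_of_ne m0 m1, dotReflection_single_nullVector_of_ne m2 m3,
    dotReflection_single_nullVector_right (hne (by decide)),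
    dotReflection_single_nullVector_of_ne (hne (by decide)) (hne (by decide))] at this

end StandardPairs

section Curvature

variable {n : ℕ}

/-- If all but two of the `n` terms of a sum equal `c`, the sum is determined. -/
lemma sum_eq_of_forall_ne_of_ne {a : Fin n → ℂ} {c : ℂ} {i j : Fin n} (hij : i ≠ j)
    (h : ∀ m, m ≠ i → m ≠ j → a m = c) : ∑ m, a m = a i + a j + (n - 2) * c := by
  have := Fintype.sum_eq_add (f := fun m => a m - c) i j hij
    (fun m hm => by simp [h m hm.1 hm.2])
  simp only [Finset.sum_sub_distrib, Finset.sum_const, Finset.card_univ, Fintype.card_fin,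
    nsmul_eq_mul] at this
  linear_combination this

/-- A Weyl tensor whose sectional curvature vanishes on the standard isotropic planes is zero. -/
lemma weyl_eq_zero_of_forall_nullVector (hn : 5 ≤ n)
    (W : (Fin n → ℂ) →ₗ[ℂ] (Fin n → ℂ) →ₗ[ℂ] (Fin n → ℂ) →ₗ[ℂ] (Fin n → ℂ) →ₗ[ℂ] ℂ)
    (hanti : ∀ X Y Z T, W X Y Z T = -W Y X Z T)
    (hpair : ∀ X Y Z T, W X Y Z T = W Z T X Y)
    (hbianchi : ∀ X Y Z T, W X Y Z T + W Y Z X T + W Z X Y T = 0)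
    (htrace : ∀ X Y, ∑ i, W (Pi.single i 1) X Y (Pi.single i 1) = 0)
    (h : ∀ i j k l : Fin n, [i, j, k, l].Nodup → ∀ s r : ℂ, s ^ 2 = -1 → r ^ 2 = -1 →
      W (nullVector k l r) (nullVector i j s) (nullVector i j s) (nullVector k l r) = 0) :
    W = 0 := by
  have hI : Complex.I ^ 2 = -1 := Complex.I_sq
  have hI' : (-Complex.I) ^ 2 = -1 := by simp
  have hI0 := Complex.I_ne_zero
  have hn2 : (n : ℂ) - 2 ≠ 0 := by
    rw [sub_ne_zero]; exact_mod_cast (by omega : n ≠ 2)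
  have hn1 : (n : ℂ) - 1 ≠ 0 := by
    rw [sub_ne_zero]; exact_mod_cast (by omega : n ≠ 1)
  have hanti' : ∀ X Y Z T, W X Y Z T = -W X Y T Z := fun X Y Z T => by
    rw [hpair, hanti, hpair]
  have hself : ∀ X Z T, W X X Z T = 0 := fun X Z T => by
    linear_combination hanti X X Z T / 2
  have hself' : ∀ X Y Z, W X Y Z Z = 0 := fun X Y Z => by
    linear_combination hanti' X Y Z Z / 2
  have hB : ∀ i j k l : Fin n, [i, j, k, l].Nodup → ∀ s : ℂ, s ^ 2 = -1 →
      W (Pi.single k 1) (nullVector i j s) (nullVector i j s) (Pi.single k 1) =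
        W (Pi.single l 1) (nullVector i j s) (nullVector i j s) (Pi.single l 1) ∧
      W (Pi.single k 1) (nullVector i j s) (nullVector i j s) (Pi.single l 1) = 0 := by
    intro i j k l hd s hs
    have h1 := h i j k l hd s _ hs hI
    have h2 := h i j k l hd s _ hs hI'
    have hsym : W (Pi.single l 1) (nullVector i j s) (nullVector i j s) (Pi.single k 1) =
        W (Pi.single k 1) (nullVector i j s) (nullVector i j s) (Pi.single l 1) := by
      rw [hpair, hanti, hanti', neg_neg]
    generalize nullVector i j s = y at *
    simp only [nullVector, map_add, map_smul, LinearMap.add_apply, LinearMap.smul_apply,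
      smul_eq_mul, hsym] at h1 h2
    constructor
    · linear_combination h1 / 2 + h2 / 2 - W (Pi.single l 1) y y (Pi.single l 1) * hI
    · apply mul_left_cancel₀ hI0
      linear_combination h1 / 4 - h2 / 4
  have hB0 : ∀ i j k : Fin n, i ≠ j → k ≠ i → k ≠ j → ∀ s : ℂ, s ^ 2 = -1 →
      W (Pi.single k 1) (nullVector i j s) (nullVector i j s) (Pi.single k 1) = 0 := by
    intro i j k hij hki hkj s hs
    have ht := htrace (nullVector i j s) (nullVector i j s)
    rw [sum_eq_of_forall_ne_of_ne hij (c := W (Pi.single k 1) (nullVector i j s)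
      (nullVector i j s) (Pi.single k 1))] at ht
    · have hsum : W (Pi.single i 1) (nullVector i j s) (nullVector i j s) (Pi.single i 1) +
          W (Pi.single j 1) (nullVector i j s) (nullVector i j s) (Pi.single j 1) = 0 := by
        simp only [nullVector, map_add, map_smul, LinearMap.add_apply, LinearMap.smul_apply,
          smul_eq_mul, hself, hself']
        rw [hpair (Pi.single j 1), hanti (Pi.single i 1) (Pi.single j 1)]
        rw [hanti' (Pi.single j 1) (Pi.single i 1)]
        linear_combination W (Pi.single j 1) (Pi.single i 1) (Pi.single i 1) (Pi.single j 1) * hs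
      rw [hsum, zero_add] at ht
      exact (mul_eq_zero.1 ht).resolve_left hn2
    · intro m hmi hmj
      by_cases hmk : m = k
      · rw [hmk]
      · exact (hB i j m k (by simp; tauto) s hs).1
  have hBall : ∀ i j k l : Fin n, i ≠ j → k ≠ i → k ≠ j → l ≠ i → l ≠ j → ∀ s : ℂ, s ^ 2 = -1 →
      W (Pi.single k 1) (nullVector i j s) (nullVector i j s) (Pi.single l 1) = 0 := by
    intro i j k l hij hki hkj hli hlj s hs
    by_cases hkl : k = l
    · subst hkl; exact hB0 i j k hij hki hkj s hs
    · exact (hB i j k l (by simp; tauto) s hs).2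
  have hR : ∀ i j k l : Fin n, i ≠ j → k ≠ i → k ≠ j → l ≠ i → l ≠ j →
      W (Pi.single k 1) (Pi.single i 1) (Pi.single i 1) (Pi.single l 1) =
        W (Pi.single k 1) (Pi.single j 1) (Pi.single j 1) (Pi.single l 1) ∧
      W (Pi.single k 1) (Pi.single i 1) (Pi.single j 1) (Pi.single l 1) =
        -W (Pi.single k 1) (Pi.single j 1) (Pi.single i 1) (Pi.single l 1) := by
    intro i j k l hij hki hkj hli hlj
    have h1 := hBall i j k l hij hki hkj hli hlj _ hI
    have h2 := hBall i j k l hij hki hkj hli hlj _ hI'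
    simp only [nullVector, map_add, map_smul, LinearMap.add_apply, LinearMap.smul_apply,
      smul_eq_mul] at h1 h2
    constructor
    · linear_combination h1 / 2 + h2 / 2 -
        W (Pi.single k 1) (Pi.single j 1) (Pi.single j 1) (Pi.single l 1) * hI
    · apply mul_left_cancel₀ hI0
      linear_combination h1 / 2 - h2 / 2
  have hmid : ∀ i k l : Fin n, W (Pi.single k 1) (Pi.single i 1) (Pi.single i 1)
      (Pi.single l 1) = 0 := by
    intro i k l
    by_cases hki : k = i
    · rw [hki, hself]
    by_cases hli : l = i
    · rw [hli, hself']
    have ht := htrace (Pi.single k 1) (Pi.single l 1)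
    have hflip : ∀ m : Fin n, W (Pi.single m 1) (Pi.single k 1) (Pi.single l 1) (Pi.single m 1) =
        W (Pi.single k 1) (Pi.single m 1) (Pi.single m 1) (Pi.single l 1) := fun m => by
      rw [hanti, hanti', neg_neg]
    simp only [hflip] at ht
    have hall : ∀ m, m ≠ k → m ≠ l →
        W (Pi.single k 1) (Pi.single m 1) (Pi.single m 1) (Pi.single l 1) =
        W (Pi.single k 1) (Pi.single i 1) (Pi.single i 1) (Pi.single l 1) := by
      intro m hmk hml
      by_cases hmi : m = i
      · rw [hmi]
      · exact (hR m i k l hmi (Ne.symm hmk) hki (Ne.symm hml) hli).1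
    by_cases hkl : k = l
    · subst hkl
      rw [sum_eq_of_forall_ne_of_ne hki (fun m hmk _ => hall m hmk hmk), hself] at ht
      apply (mul_eq_zero.1 (_ : ((n : ℂ) - 1) * _ = 0)).resolve_left hn1
      linear_combination ht
    · rw [sum_eq_of_forall_ne_of_ne hkl hall, hself, hself', zero_add, zero_add] at ht
      exact (mul_eq_zero.1 ht).resolve_left hn2
  have hzero : ∀ a b c d : Fin n,
      W (Pi.single a 1) (Pi.single b 1) (Pi.single c 1) (Pi.single d 1) = 0 := by
    intro a b c d
    by_cases hab : a = b
    · rw [hab, hself]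
    by_cases hcd : c = d
    · rw [hcd, hself']
    by_cases hbc : b = c
    · rw [hbc, hmid]
    by_cases hac : a = c
    · rw [hac, hanti, hmid, neg_zero]
    by_cases hbd : b = d
    · rw [hbd, hanti', hmid, neg_zero]
    by_cases had : a = d
    · rw [had, hanti, hanti', hmid, neg_zero, neg_zero]
    have h1 := (hR b c a d hbc hab hac (Ne.symm hbd) (Ne.symm hcd)).2
    have h2 := (hR a b c d hab (Ne.symm hac) (Ne.symm hbc) (Ne.symm had) (Ne.symm hbd)).2
    have h3 := hanti (Pi.single a 1) (Pi.single c 1) (Pi.single b 1) (Pi.single d 1)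
    have h4 := hanti (Pi.single c 1) (Pi.single b 1) (Pi.single a 1) (Pi.single d 1)
    have h5 := hbianchi (Pi.single a 1) (Pi.single b 1) (Pi.single c 1) (Pi.single d 1)
    linear_combination (2 * h1 - 2 * h3 + h5 + h2 - h4) / 3
  refine LinearMap.pi_ext' fun a => LinearMap.ext_ring <| LinearMap.pi_ext' fun b =>
    LinearMap.ext_ring <| LinearMap.pi_ext' fun c => LinearMap.ext_ring <|
    LinearMap.pi_ext' fun d => LinearMap.ext_ring ?_
  simpa using hzero a b c d

lemma differentiable_apply₄
    (W : (Fin n → ℂ) →ₗ[ℂ] (Fin n → ℂ) →ₗ[ℂ] (Fin n → ℂ) →ₗ[ℂ] (Fin n → ℂ) →ₗ[ℂ] ℂ)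
    {a b c d : ℂ → Fin n → ℂ} (ha : Differentiable ℂ a) (hb : Differentiable ℂ b)
    (hc : Differentiable ℂ c) (hd : Differentiable ℂ d) :
    Differentiable ℂ fun t => W (a t) (b t) (c t) (d t) := by
  have hexp : ∀ x : Fin n → ℂ, x = ∑ i, x i • Pi.single i (1 : ℂ) := fun x =>
    pi_eq_sum_univ' x
  have hW : ∀ x y z w, W x y z w = ∑ l, ∑ k, ∑ j, ∑ i, w l * (z k * (y j * (x i *
      W (Pi.single i 1) (Pi.single j 1) (Pi.single k 1) (Pi.single l 1)))) := by
    intro x y z w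
    conv_lhs => rw [hexp x, hexp y, hexp z, hexp w]
    simp only [map_sum, map_smul, LinearMap.sum_apply, LinearMap.smul_apply, smul_eq_mul,
      Finset.mul_sum]
  rw [funext fun t => hW (a t) (b t) (c t) (d t)]
  fun_prop

end Curvature

/- STATEMENT 13: Let `V = ℂⁿ` (`n ≥ 5`) with the standard nondegenerate symmetric
bilinear form `g(X,Y) = ∑ Xᵢ Yᵢ`. Let `W` be an algebraic Weyl tensor (an
algebraic curvature tensor with vanishing Ricci contraction), presented as the
4-tensor `W X Y Z T = ⟨W(X,Y)Z,T⟩`. If the sectional curvature of `W` vanishes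
on every totally isotropic 2-plane belonging to a nonempty open subset of the
Grassmannian of totally isotropic 2-planes (presented as a nonempty open set of
isotropic spanning pairs), then `W = 0`. -/
theorem stmt_13 (n : ℕ) (hn : 5 ≤ n)
    (W : (Fin n → ℂ) →ₗ[ℂ] (Fin n → ℂ) →ₗ[ℂ] (Fin n → ℂ) →ₗ[ℂ] (Fin n → ℂ) →ₗ[ℂ] ℂ)
    (g : (Fin n → ℂ) → (Fin n → ℂ) → ℂ)
    (hg : ∀ X Y, g X Y = ∑ i, X i * Y i)
    (hanti : ∀ X Y Z T, W X Y Z T = -W Y X Z T)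
    (hpair : ∀ X Y Z T, W X Y Z T = W Z T X Y)
    (hbianchi : ∀ X Y Z T, W X Y Z T + W Y Z X T + W Z X Y T = 0)
    (htrace : ∀ X Y, ∑ i, W (Pi.single i 1) X Y (Pi.single i 1) = 0)
    (S : Set {p : (Fin n → ℂ) × (Fin n → ℂ) //
      g p.1 p.1 = 0 ∧ g p.1 p.2 = 0 ∧ g p.2 p.2 = 0 ∧ LinearIndependent ℂ ![p.1, p.2]})
    (hSopen : IsOpen S) (hSne : S.Nonempty)
    (hvanish : ∀ p ∈ S, W p.1.1 p.1.2 p.1.2 p.1.1 = 0) :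
    W = 0 := by
  have hgd : ∀ X Y, g X Y = X ⬝ᵥ Y := hg
  have hf : ∀ a b : ℂ → Fin n → ℂ, Differentiable ℂ a → Differentiable ℂ b →
      Differentiable ℂ fun t => W (a t) (b t) (b t) (a t) :=
    fun a b ha hb => differentiable_apply₄ W ha hb hb ha
  have hsmul : ∀ (c : ℂ) x y, W (c • x) (c • y) (c • y) (c • x) = c ^ 4 * W x y y x := by
    intro c x y
    simp only [map_smul, LinearMap.smul_apply, smul_eq_mul]
    ring
  have hself : ∀ X Z T, W X X Z T = 0 := fun X Z T => by
    linear_combination hanti X X Z T / 2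
  obtain ⟨⟨⟨x, y⟩, h1, h2, h3, hli⟩, hpS⟩ := hSne
  have hnear : VanishesNear (fun X Y => W X Y Y X) (x, y) := by
    obtain ⟨O, hO, rfl⟩ := isOpen_induced_iff.1 hSopen
    filter_upwards [hO.mem_nhds hpS] with q hq hiso
    by_cases hqli : LinearIndependent ℂ ![q.1, q.2]
    · exact hvanish ⟨q, by rw [hgd]; exact hiso.1, by rw [hgd]; exact hiso.2.1,
        by rw [hgd]; exact hiso.2.2, hqli⟩ hq
    · rw [LinearIndependent.pair_iff] at hqli
      push Not at hqli
      obtain ⟨s, t, hst, hne⟩ := hqli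
      have hs : s * W q.1 q.2 q.2 q.1 = 0 := by
        have := congrArg (fun z => W z q.2 q.2 q.1) hst
        simpa [hself] using this
      have ht : t * W q.1 q.2 q.2 q.1 = 0 := by
        have := congrArg (fun z => W q.1 z q.2 q.1) hst
        simpa [hself] using this
      by_cases hs0 : s = 0
      · exact (mul_eq_zero.1 ht).resolve_left (hne hs0)
      · exact (mul_eq_zero.1 hs).resolve_left hs0
  rw [hgd] at h1 h2 h3
  obtain ⟨e, s, r, hs, hr, hstd⟩ := hnear.exists_nullVector hn hf hsmul ⟨h1, h2, h3⟩ hli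
  refine weyl_eq_zero_of_forall_nullVector hn W hanti hpair hbianchi htrace ?_
  intro i j k l hd s' r' hs' hr'
  have hinj : Function.Injective ![k, l, i, j] := by
    rw [← List.nodup_ofFn]
    simp only [List.nodup_cons, List.mem_cons, List.not_mem_nil, or_false, not_or] at hd
    simp [List.ofFn_succ]
    grind
  have hv := (hstd.nullVector_of_nullVector hn hf hsmul hs hr ⟨_, hinj⟩ hr' hs').self_of_nhds
  have hne : ∀ a b, a ≠ b → ![k, l, i, j] a ≠ ![k, l, i, j] b := fun a b => hinj.ne
  exact hv ⟨nullVector_dotProduct_self (hne 0 1 (by decide)) hr',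
    nullVector_dotProduct_of_disjoint (hne 0 2 (by decide)) (hne 0 3 (by decide))
      (hne 1 2 (by decide)) (hne 1 3 (by decide)) _ _,
    nullVector_dotProduct_self (hne 2 3 (by decide)) hs'⟩
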